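/- arXiv:2203.11705 — 2 statements merged into one kernel-verified Lean document; each statement's English description precedes it below -/
import Mathlib

section
/- Let 1 < α < 2 and let s be a real number. There exist constants 0 < c ≤ C such that for every integer i ≥ 1, c · (1+i²)^{s} ≤ (1+(i−1)²)^{s−(α−1)} · (Γ(i+α)/Γ(i+1))² ≤ C · (1+i²)^{s}. -/
/-- Powers of comparable positive numbers are comparable. -/
theorem rpow_le_const_mul_rpow_of_comparable {a b K : ℝ} (ha : 0 < a) (hb : 0 < b) (hK : 0 < K)
    (hab : a ≤ K * b) (hba : b ≤ K * a) (t : ℝ) : a ^ t ≤ K ^ |t| * b ^ t := by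
  rcases le_total 0 t with ht | ht
  · rw [abs_of_nonneg ht, ← Real.mul_rpow hK.le hb.le]
    exact Real.rpow_le_rpow ha.le hab ht
  · have h : (K * a) ^ t ≤ b ^ t := Real.rpow_le_rpow_of_nonpos hb hba ht
    rw [Real.mul_rpow hK.le ha.le] at h
    calc a ^ t = K ^ (-t) * (K ^ t * a ^ t) := by
          rw [← mul_assoc, ← Real.rpow_add hK]; simp
      _ ≤ K ^ |t| * b ^ t := by
          rw [abs_of_nonpos ht]; gcongr

/-- Upper Gautschi inequality. -/
theorem Gamma_add_le_rpow_mul_Gamma {x β : ℝ} (hx : 0 < x) (hβ0 : 0 < β) (hβ1 : β < 1) :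
    Real.Gamma (x + β) ≤ x ^ β * Real.Gamma x := by
  have hG := Real.Gamma_pos_of_pos hx
  have h := Real.Gamma_mul_add_mul_le_rpow_Gamma_mul_rpow_Gamma hx (show 0 < x + 1 by linarith)
    (show 0 < 1 - β by linarith) hβ0 (by ring)
  rw [Real.Gamma_add_one hx.ne', Real.mul_rpow hx.le hG.le] at h
  calc Real.Gamma (x + β) = Real.Gamma ((1 - β) * x + β * (x + 1)) := by ring_nf
    _ ≤ _ := h
    _ = x ^ β * (Real.Gamma x ^ (1 - β) * Real.Gamma x ^ β) := by ring
    _ = x ^ β * Real.Gamma x := by rw [← Real.rpow_add hG]; simp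

/-- A lower bound of Gautschi type. -/
theorem rpow_mul_Gamma_le_two_mul_Gamma_add {x β : ℝ} (hx : 1 ≤ x) (hβ0 : 0 < β) (hβ1 : β < 1) :
    x ^ β * Real.Gamma x ≤ 2 * Real.Gamma (x + β) := by
  have hx0 : 0 < x := by linarith
  have hG := Real.Gamma_pos_of_pos (show 0 < x + β by linarith)
  have h := Gamma_add_le_rpow_mul_Gamma (x := x + β) (β := 1 - β) (by linarith) (by linarith)
    (by linarith)
  rw [show x + β + (1 - β) = x + 1 by ring, Real.Gamma_add_one hx0.ne'] at h
  have h2 : (x + β) ^ (1 - β) ≤ 2 * x ^ (1 - β) :=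
    calc (x + β) ^ (1 - β) ≤ (2 * x) ^ (1 - β) :=
          Real.rpow_le_rpow (by linarith) (by linarith) (by linarith)
      _ = 2 ^ (1 - β) * x ^ (1 - β) := Real.mul_rpow (by norm_num) hx0.le
      _ ≤ 2 ^ (1 : ℝ) * x ^ (1 - β) := by
          gcongr
          · norm_num
          · linarith
      _ = 2 * x ^ (1 - β) := by simp
  have hsplit : x ^ (1 - β) * x ^ β = x := by rw [← Real.rpow_add hx0]; simp
  refine le_of_mul_le_mul_left ?_ (Real.rpow_pos_of_pos hx0 (1 - β))
  calc x ^ (1 - β) * (x ^ β * Real.Gamma x) = x * Real.Gamma x := by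
        rw [← mul_assoc, hsplit]
    _ ≤ (x + β) ^ (1 - β) * Real.Gamma (x + β) := h
    _ ≤ 2 * x ^ (1 - β) * Real.Gamma (x + β) := by gcongr
    _ = x ^ (1 - β) * (2 * Real.Gamma (x + β)) := by ring

open Real

/-- diagonal coefficient estimate underlying Lemma 4.1. -/
theorem shifted_diag_comparable (α s : ℝ) (hα1 : 1 < α) (hα2 : α < 2) :
    ∃ c C : ℝ, 0 < c ∧ c ≤ C ∧ ∀ i : ℕ, 1 ≤ i →
      c * (1 + (i : ℝ) ^ 2) ^ s ≤
        (1 + ((i : ℝ) - 1) ^ 2) ^ (s - (α - 1)) *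
          (Real.Gamma ((i : ℝ) + α) / Real.Gamma ((i : ℝ) + 1)) ^ 2 ∧
      (1 + ((i : ℝ) - 1) ^ 2) ^ (s - (α - 1)) *
          (Real.Gamma ((i : ℝ) + α) / Real.Gamma ((i : ℝ) + 1)) ^ 2 ≤
        C * (1 + (i : ℝ) ^ 2) ^ s := by
  set β := α - 1 with hβ
  set K : ℝ := 3 ^ |s - β| with hK
  have hβ0 : 0 < β := by linarith
  have hβ1 : β < 1 := by linarith
  have hK1 : 1 ≤ K := Real.one_le_rpow (by norm_num) (abs_nonneg _)
  have hK0 : 0 < K := by linarith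
  refine ⟨K⁻¹ * (1 / 4), K * 2, by positivity, ?_, ?_⟩
  · have := inv_le_one_of_one_le₀ hK1
    linarith
  intro i hi
  have hi1 : (1 : ℝ) ≤ i := by exact_mod_cast hi
  set A : ℝ := 1 + (i : ℝ) ^ 2 with hA
  set B : ℝ := 1 + ((i : ℝ) - 1) ^ 2 with hB
  set x : ℝ := (i : ℝ) + 1 with hx
  have hA0 : 0 < A := by positivity
  have hB0 : 0 < B := by positivity
  have hx0 : 0 < x := by positivity
  have hG := Real.Gamma_pos_of_pos hx0
  have hAB : A ≤ 3 * B := by nlinarith [sq_nonneg (2 * (i : ℝ) - 3)]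
  have hBA : B ≤ 3 * A := by nlinarith
  have hAx : A ≤ x ^ 2 := by nlinarith
  have hxA : x ^ 2 ≤ 2 * A := by nlinarith [sq_nonneg ((i : ℝ) - 1)]
  have hBK : B ^ (s - β) ≤ K * A ^ (s - β) :=
    rpow_le_const_mul_rpow_of_comparable hB0 hA0 (by norm_num) hBA hAB _
  have hKB : K⁻¹ * A ^ (s - β) ≤ B ^ (s - β) := by
    rw [inv_mul_le_iff₀ hK0]
    exact rpow_le_const_mul_rpow_of_comparable hA0 hB0 (by norm_num) hAB hBA _
  have hAs : A ^ (s - β) * A ^ β = A ^ s := by rw [← Real.rpow_add hA0]; simp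
  have hsq : (x ^ β) ^ 2 = (x ^ 2) ^ β := by
    rw [← Real.rpow_natCast, ← Real.rpow_natCast, ← Real.rpow_mul hx0.le, ← Real.rpow_mul hx0.le,
      mul_comm]
  rw [show (i : ℝ) + α = x + β by rw [hx, hβ]; ring]
  set r := Real.Gamma (x + β) / Real.Gamma x with hr
  have hr_le : r ≤ x ^ β := by
    rw [hr, div_le_iff₀ hG]
    exact Gamma_add_le_rpow_mul_Gamma hx0 hβ0 hβ1
  have hr_ge : x ^ β / 2 ≤ r := by
    rw [hr, le_div_iff₀ hG]
    linarith [rpow_mul_Gamma_le_two_mul_Gamma_add (x := x) (by linarith) hβ0 hβ1]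
  have hr0 : 0 ≤ r := le_trans (by positivity) hr_ge
  have hr2_le : r ^ 2 ≤ 2 * A ^ β :=
    calc r ^ 2 ≤ (x ^ β) ^ 2 := by gcongr
      _ = (x ^ 2) ^ β := hsq
      _ ≤ (2 * A) ^ β := by gcongr
      _ = 2 ^ β * A ^ β := Real.mul_rpow (by norm_num) hA0.le
      _ ≤ 2 ^ (1 : ℝ) * A ^ β := by
          gcongr
          norm_num
      _ = 2 * A ^ β := by simp
  have hr2_ge : 1 / 4 * A ^ β ≤ r ^ 2 :=
    calc 1 / 4 * A ^ β ≤ 1 / 4 * (x ^ 2) ^ β := by gcongr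
      _ = (x ^ β / 2) ^ 2 := by rw [← hsq]; ring
      _ ≤ r ^ 2 := by gcongr
  constructor
  · calc K⁻¹ * (1 / 4) * A ^ s = (K⁻¹ * A ^ (s - β)) * (1 / 4 * A ^ β) := by rw [← hAs]; ring
      _ ≤ B ^ (s - β) * r ^ 2 := by gcongr
  · calc B ^ (s - β) * r ^ 2 ≤ (K * A ^ (s - β)) * (2 * A ^ β) := by gcongr
      _ = K * 2 * A ^ s := by rw [← hAs]; ring
end

section
/- Let H₁ and H₂ be real Hilbert spaces, let B : H₁ × H₂ → ℝ be a bilinear map, and let F : H₂ → ℝ be a bounded linear functional. Suppose there are constants C₁ < ∞ and C₂ > 0 such that: (i) |B(w,v)| ≤ C₁ ‖w‖ ‖v‖ for all w ∈ H₁ and v ∈ H₂; (ii) sup_{0 ≠ v ∈ H₂} |B(w,v)| / ‖v‖ ≥ C₂ ‖w‖ for all w ∈ H₁; and (iii) for every v ∈ H₂ with v ≠ 0, sup_{w ∈ H₁} |B(w,v)| > 0. Then there exists a unique w₀ ∈ H₁ such that B(w₀, v) = F(v) for all v ∈ H₂, and moreover ‖w₀‖ ≤ ‖F‖ / C₂.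 -/
open Real

/-- The supremum over nonzero vectors of the quotients `|f v| / ‖v‖` is at most the operator norm. -/
theorem ContinuousLinearMap.iSup_abs_div_norm_le {E : Type*} [NormedAddCommGroup E]
    [NormedSpace ℝ E] (f : E →L[ℝ] ℝ) : ⨆ v : E, ⨆ _ : v ≠ 0, |f v| / ‖v‖ ≤ ‖f‖ :=
  Real.iSup_le (fun v ↦ Real.iSup_le (fun _ ↦ f.ratio_le_opNorm v) (norm_nonneg f))
    (norm_nonneg f)

/-- A continuous linear map between Hilbert spaces which is bounded below and whose range has
trivial orthogonal complement is surjective. -/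
theorem ContinuousLinearMap.surjective_of_bound_of_orthogonal_range {E G : Type*}
    [NormedAddCommGroup E] [InnerProductSpace ℝ E] [CompleteSpace E]
    [NormedAddCommGroup G] [InnerProductSpace ℝ G]
    (A : E →L[ℝ] G) {c : ℝ} (hc : 0 < c) (hA : ∀ x, c * ‖x‖ ≤ ‖A x‖)
    (horth : ∀ y : G, (∀ x, inner ℝ (A x) y = 0) → y = 0) : Function.Surjective A := by
  have hanti : AntilipschitzWith (c⁻¹).toNNReal A := by
    refine A.antilipschitz_of_bound fun x ↦ ?_
    rw [Real.coe_toNNReal _ (inv_pos.mpr hc).le, ← div_eq_inv_mul, le_div_iff₀' hc]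
    exact hA x
  have : CompleteSpace A.range :=
    (hanti.isComplete_range A.uniformContinuous).completeSpace_coe
  refine LinearMap.range_eq_top.mp (Submodule.orthogonal_eq_bot_iff.mp ?_)
  exact (Submodule.eq_bot_iff _).mpr fun y hy ↦ horth y fun x ↦ hy _ ⟨x, rfl⟩

/-- Banach–Nečas–Babuška theorem. -/
theorem banach_necas_babuska
    {H₁ H₂ : Type*}
    [NormedAddCommGroup H₁] [InnerProductSpace ℝ H₁] [CompleteSpace H₁]
    [NormedAddCommGroup H₂] [InnerProductSpace ℝ H₂] [CompleteSpace H₂]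
    (B : H₁ →ₗ[ℝ] H₂ →ₗ[ℝ] ℝ) (F : H₂ →L[ℝ] ℝ) (C₁ C₂ : ℝ) (hC₂ : 0 < C₂)
    (hcont : ∀ w : H₁, ∀ v : H₂, |B w v| ≤ C₁ * ‖w‖ * ‖v‖)
    (hinfsup : ∀ w : H₁, C₂ * ‖w‖ ≤ ⨆ v : H₂, ⨆ _ : v ≠ 0, |B w v| / ‖v‖)
    (hpos : ∀ v : H₂, v ≠ 0 → ∃ w : H₁, 0 < |B w v|) :
    ∃ w₀ : H₁, (∀ v : H₂, B w₀ v = F v) ∧ ‖w₀‖ ≤ ‖F‖ / C₂ ∧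
      ∀ w : H₁, (∀ v : H₂, B w v = F v) → w = w₀ := by
  let T : H₁ →L[ℝ] H₂ →L[ℝ] ℝ := B.mkContinuous₂ C₁ hcont
  have hT : ∀ w, C₂ * ‖w‖ ≤ ‖T w‖ := fun w ↦ (hinfsup w).trans (T w).iSup_abs_div_norm_le
  let A : H₁ →L[ℝ] H₂ :=
    { toFun := fun w ↦ (InnerProductSpace.toDual ℝ H₂).symm (T w)
      map_add' := fun x y ↦ by simp
      map_smul' := fun c x ↦ by simp
      cont := (InnerProductSpace.toDual ℝ H₂).symm.continuous.comp T.continuous }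
  have hA : ∀ w v, inner ℝ (A w) v = B w v := fun w _ ↦
    InnerProductSpace.toDual_symm_apply (y := T w)
  have hnorm : ∀ w, ‖A w‖ = ‖T w‖ := fun w ↦
    (InnerProductSpace.toDual ℝ H₂).symm.norm_map (T w)
  have hsurj : Function.Surjective A := by
    refine A.surjective_of_bound_of_orthogonal_range hC₂ (fun w ↦ hnorm w ▸ hT w) fun v hv ↦ ?_
    by_contra hne
    obtain ⟨w, hw⟩ := hpos v hne
    exact abs_pos.mp hw (hA w v ▸ hv w)
  obtain ⟨w₀, hw₀⟩ := hsurj ((InnerProductSpace.toDual ℝ H₂).symm F)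
  have hsol : ∀ v, B w₀ v = F v := fun v ↦ by
    rw [← hA, hw₀, InnerProductSpace.toDual_symm_apply]
  refine ⟨w₀, hsol, ?_, fun w hw ↦ ?_⟩
  · have hTF : T w₀ = F := ContinuousLinearMap.ext hsol
    rw [le_div_iff₀' hC₂, ← hTF]
    exact hT w₀
  · have hTw : T (w - w₀) = 0 := ContinuousLinearMap.ext fun v ↦ by
      simp [T, hw v, hsol v]
    have hle := hT (w - w₀)
    rw [hTw, norm_zero] at hle
    exact sub_eq_zero.mp (norm_le_zero_iff.mp (nonpos_of_mul_nonpos_right hle hC₂))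
end
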